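/- Let R_Λ(x) = (⟨R_θ M_0(x - σ), M_1(x)⟩, ⟨R_θ M_0(x - σ), M_2⟩) for Λ = (θ, σ) ∈ ℝ², and let h : ℝ² → ℝ² be h(Λ) = (⟨R_Λ, a₁⟩_{L²}, ⟨R_Λ, a₂⟩_{L²}) where a₁ = (0, sech), a₂ = (sech, 0). Then h is smooth near 0 and its differential at Λ = 0 equals -2·Id; hence h is a local diffeomorphism at the origin. -/

import Mathlib

open Real MeasureTheory

/-- The derivative of `tanh` is `1 - tanh²`. -/
theorem hasDerivAt_tanh_one_sub_sq (x : ℝ) : HasDerivAt tanh (1 - tanh x ^ 2) x := by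
  have hc : cosh x ≠ 0 := (cosh_pos x).ne'
  have h := (hasDerivAt_sinh x).div (hasDerivAt_cosh x) hc
  have hf : tanh = sinh / cosh := by
    funext y
    exact tanh_eq_sinh_div_cosh y
  rw [hf]
  refine h.congr_deriv ?_
  simp only [Pi.div_apply]
  field_simp

/-- `sech² = 1 - tanh²`. -/
theorem inv_cosh_sq_eq (x : ℝ) : (cosh x)⁻¹ ^ 2 = 1 - tanh x ^ 2 := by
  have hc : cosh x ≠ 0 := (cosh_pos x).ne'
  rw [tanh_eq_sinh_div_cosh]
  field_simp
  linarith [cosh_sq x]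

theorem hasDerivAt_inv_cosh (x : ℝ) :
    HasDerivAt (fun y => (cosh y)⁻¹) (-((cosh x)⁻¹ * tanh x)) x := by
  have hc : cosh x ≠ 0 := (cosh_pos x).ne'
  refine ((hasDerivAt_cosh x).fun_inv hc).congr_deriv ?_
  rw [tanh_eq_sinh_div_cosh]
  field_simp

theorem continuous_real_tanh : Continuous tanh :=
  continuous_iff_continuousAt.2 fun x => (hasDerivAt_tanh_one_sub_sq x).continuousAt

theorem continuous_inv_cosh : Continuous fun x : ℝ => (cosh x)⁻¹ :=
  continuous_iff_continuousAt.2 fun x => (hasDerivAt_inv_cosh x).continuousAt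

theorem inv_cosh_le_one (x : ℝ) : (cosh x)⁻¹ ≤ 1 := inv_le_one_of_one_le₀ (one_le_cosh x)

theorem one_add_sq_div_two_le_cosh (x : ℝ) : 1 + x ^ 2 / 2 ≤ cosh x := by
  have h1 : cosh x = 1 + 2 * sinh (x / 2) ^ 2 := by
    have h := cosh_two_mul (x / 2)
    rw [mul_div_cancel₀ x two_ne_zero] at h
    linarith [cosh_sq (x / 2)]
  have h2 : |x / 2| ≤ |sinh (x / 2)| := by
    rw [abs_sinh]
    exact self_le_sinh_iff.2 (abs_nonneg _)
  linarith [sq_le_sq.2 h2]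

theorem integrable_inv_cosh : Integrable fun x : ℝ => (cosh x)⁻¹ := by
  refine (integrable_inv_one_add_sq.const_mul 2).mono' continuous_inv_cosh.aestronglyMeasurable
    (ae_of_all _ fun x => ?_)
  have hc := cosh_pos x
  rw [norm_of_nonneg (inv_pos.2 hc).le, ← div_eq_mul_inv, inv_eq_one_div,
    div_le_div_iff₀ hc (by positivity)]
  linarith [one_add_sq_div_two_le_cosh x]

open Filter Topology in
theorem tendsto_tanh_atTop_one : Tendsto tanh atTop (𝓝 1) := by
  have hf : tanh = fun x => 1 - 2 * (exp (2 * x) + 1)⁻¹ := by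
    funext x
    have h : exp (2 * x) = exp x * exp x := by rw [two_mul, exp_add]
    have := exp_pos x
    rw [tanh_eq, h, exp_neg]
    field_simp
    ring
  rw [hf]
  have h : Tendsto (fun x : ℝ => exp (2 * x) + 1) atTop atTop :=
    tendsto_atTop_add_const_right _ _
      (tendsto_exp_atTop.comp (tendsto_id.const_mul_atTop two_pos))
  simpa using (h.inv_tendsto_atTop.const_mul 2).const_sub 1

open Filter Topology in
theorem tendsto_tanh_atBot_neg_one : Tendsto tanh atBot (𝓝 (-1)) := by
  have h := (tendsto_tanh_atTop_one.comp tendsto_neg_atBot_atTop).neg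
  refine h.congr fun x => ?_
  simp [tanh_neg]

theorem integral_inv_cosh_sq : ∫ x : ℝ, (cosh x)⁻¹ ^ 2 = 2 := by
  have hi : Integrable fun x : ℝ => (cosh x)⁻¹ ^ 2 := by
    simp_rw [sq]
    refine integrable_inv_cosh.bdd_mul (c := 1) continuous_inv_cosh.aestronglyMeasurable
      (ae_of_all _ fun x => ?_)
    rw [norm_of_nonneg (inv_pos.2 (cosh_pos x)).le]
    exact inv_cosh_le_one x
  rw [integral_of_hasDerivAt_of_tendsto
    (fun x => (hasDerivAt_tanh_one_sub_sq x).congr_deriv (inv_cosh_sq_eq x).symm) hi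
    tendsto_tanh_atBot_neg_one tendsto_tanh_atTop_one]
  norm_num

open Polynomial in
/-- The function `p(tanh) + sech · q(tanh)`; this family is closed under differentiation. -/
noncomputable def tanhSech (p q : ℝ[X]) (x : ℝ) : ℝ :=
  p.eval (tanh x) + (cosh x)⁻¹ * q.eval (tanh x)

section TanhSech

open Polynomial

theorem hasDerivAt_tanhSech (p q : ℝ[X]) (x : ℝ) :
    HasDerivAt (tanhSech p q)
      (tanhSech (derivative p * (1 - X ^ 2)) (derivative q * (1 - X ^ 2) - X * q) x) x := by
  have ht := hasDerivAt_tanh_one_sub_sq x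
  have hp := (p.hasDerivAt (tanh x)).comp x ht
  have hq := (q.hasDerivAt (tanh x)).comp x ht
  refine (hp.add ((hasDerivAt_inv_cosh x).mul hq)).congr_deriv ?_
  simp only [tanhSech, eval_mul, eval_sub, eval_one, eval_pow, eval_X, Function.comp_apply]
  ring

theorem continuous_tanhSech (p q : ℝ[X]) : Continuous (tanhSech p q) :=
  continuous_iff_continuousAt.2 fun x => (hasDerivAt_tanhSech p q x).continuousAt

theorem exists_bound_eval_tanh (p : ℝ[X]) : ∃ C, ∀ x, ‖p.eval (tanh x)‖ ≤ C := by
  obtain ⟨C, hC⟩ := (isCompact_Icc (a := (-1 : ℝ)) (b := 1)).exists_bound_of_continuousOn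
    p.continuous.continuousOn
  exact ⟨C, fun x => hC _ ⟨(neg_one_lt_tanh x).le, (tanh_lt_one x).le⟩⟩

theorem exists_bound_tanhSech (p q : ℝ[X]) : ∃ C, ∀ x, ‖tanhSech p q x‖ ≤ C := by
  obtain ⟨C, hC⟩ := exists_bound_eval_tanh p
  obtain ⟨D, hD⟩ := exists_bound_eval_tanh q
  refine ⟨C + D, fun x => (norm_add_le _ _).trans (add_le_add (hC x) ?_)⟩
  rw [norm_mul, norm_of_nonneg (inv_pos.2 (cosh_pos x)).le]
  exact (mul_le_of_le_one_left (norm_nonneg _) (inv_cosh_le_one x)).trans (hD x)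

theorem integrable_tanhSech_sub_mul (p q : ℝ[X]) {w : ℝ → ℝ} (hw : Integrable w) (σ : ℝ) :
    Integrable fun x => tanhSech p q (x - σ) * w x := by
  obtain ⟨C, hC⟩ := exists_bound_tanhSech p q
  exact hw.bdd_mul ((continuous_tanhSech p q).comp (continuous_sub_right σ)).aestronglyMeasurable
    (ae_of_all _ fun x => hC _)

theorem hasDerivAt_integral_tanhSech (p q : ℝ[X]) {w : ℝ → ℝ} (hw : Integrable w) (σ : ℝ) :
    HasDerivAt (fun σ => ∫ x, tanhSech p q (x - σ) * w x)
      (-∫ x, tanhSech (derivative p * (1 - X ^ 2)) (derivative q * (1 - X ^ 2) - X * q) (x - σ)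
        * w x) σ := by
  obtain ⟨C, hC⟩ := exists_bound_tanhSech (derivative p * (1 - X ^ 2))
    (derivative q * (1 - X ^ 2) - X * q)
  rw [← integral_neg]
  refine (hasDerivAt_integral_of_dominated_loc_of_deriv_le (bound := fun x => C * ‖w x‖)
    (F := fun σ x => tanhSech p q (x - σ) * w x)
    (F' := fun σ x => -(tanhSech (derivative p * (1 - X ^ 2))
      (derivative q * (1 - X ^ 2) - X * q) (x - σ) * w x)) Filter.univ_mem
    (Filter.Eventually.of_forall fun τ =>
      (integrable_tanhSech_sub_mul p q hw τ).aestronglyMeasurable)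
    (integrable_tanhSech_sub_mul p q hw σ)
    (integrable_tanhSech_sub_mul _ _ hw σ).neg.aestronglyMeasurable
    (ae_of_all _ fun x τ _ => ?_) (hw.norm.const_mul C) (ae_of_all _ fun x τ _ => ?_)).2
  · rw [norm_neg, norm_mul]
    exact mul_le_mul_of_nonneg_right (hC _) (norm_nonneg _)
  · have h := (hasDerivAt_tanhSech p q (x - τ)).comp τ ((hasDerivAt_id τ).const_sub x)
    refine (h.mul_const (w x)).congr_deriv ?_
    ring

theorem contDiff_integral_tanhSech {w : ℝ → ℝ} (hw : Integrable w) (p q : ℝ[X]) :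
    ContDiff ℝ (⊤ : ℕ∞) fun σ => ∫ x, tanhSech p q (x - σ) * w x := by
  refine contDiff_infty.2 fun n => ?_
  induction n generalizing p q with
  | zero =>
    exact contDiff_zero.2 (continuous_iff_continuousAt.2 fun σ =>
      (hasDerivAt_integral_tanhSech p q hw σ).continuousAt)
  | succ n ih =>
    have hd := hasDerivAt_integral_tanhSech p q hw
    push_cast
    refine contDiff_succ_iff_deriv.2 ⟨fun σ => (hd σ).differentiableAt, by simp, ?_⟩
    rw [funext fun σ => (hd σ).deriv]
    exact (ih _ _).neg

end TanhSech

theorem integrable_tanh_mul_inv_cosh : Integrable fun x : ℝ => tanh x * (cosh x)⁻¹ :=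
  integrable_inv_cosh.bdd_mul (c := 1) continuous_real_tanh.aestronglyMeasurable
    (ae_of_all _ fun x => (abs_tanh_lt_one x).le)

theorem integrable_inv_cosh_sq : Integrable fun x : ℝ => (cosh x)⁻¹ * (cosh x)⁻¹ :=
  integrable_inv_cosh.bdd_mul (c := 1) continuous_inv_cosh.aestronglyMeasurable
    (ae_of_all _ fun x => by
      rw [norm_of_nonneg (inv_pos.2 (cosh_pos x)).le]
      exact inv_cosh_le_one x)

/-- Let `R_Λ(x)` be the coordinates of `M_Λ(x) = R_θ M₀(x-σ)` in the mobile frame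
`(M₁(x), M₂)`, and `h(Λ) = (⟨R_Λ, a₁⟩_{L²}, ⟨R_Λ, a₂⟩_{L²})` with `a₁ = (0, sech)`,
`a₂ = (sech, 0)`. Then `h` is smooth near `0`, `dh(0) = -2·Id`, and `h` is a local
diffeomorphism at the origin. -/
theorem h_local_diffeo :
    let RΛ : ℝ × ℝ → ℝ → ℝ × ℝ := fun Λ x =>
      (Real.tanh (x - Λ.2) * (1 / Real.cosh x)
          - Real.cos Λ.1 * (1 / Real.cosh (x - Λ.2)) * Real.tanh x,
       -Real.sin Λ.1 * (1 / Real.cosh (x - Λ.2)))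
    let h : ℝ × ℝ → ℝ × ℝ := fun Λ =>
      (∫ x : ℝ, (RΛ Λ x).2 * (1 / Real.cosh x),
       ∫ x : ℝ, (RΛ Λ x).1 * (1 / Real.cosh x))
    ContDiffAt ℝ (⊤ : ℕ∞) h (0, 0) ∧
    HasFDerivAt h ((-2 : ℝ) • ContinuousLinearMap.id ℝ (ℝ × ℝ)) (0, 0) ∧
    (∃ g : ℝ × ℝ → ℝ × ℝ, ContinuousAt g (h (0, 0)) ∧
      (∀ᶠ Λ in nhds ((0, 0) : ℝ × ℝ), g (h Λ) = Λ) ∧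
      (∀ᶠ y in nhds (h (0, 0)), h (g y) = y)) := by
  intro RΛ h
  set A : ℝ → ℝ := fun σ => ∫ x, tanhSech Polynomial.X 0 (x - σ) * ((cosh x)⁻¹ * (cosh x)⁻¹)
    with hA
  set B : ℝ → ℝ := fun σ => ∫ x, tanhSech 0 1 (x - σ) * (tanh x * (cosh x)⁻¹) with hB
  set C : ℝ → ℝ := fun σ => ∫ x, tanhSech 0 1 (x - σ) * (cosh x)⁻¹ with hC
  have hh : h = fun Λ => (-sin Λ.1 * C Λ.2, A Λ.2 - cos Λ.1 * B Λ.2) := by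
    funext Λ
    refine Prod.ext ?_ ?_
    · simp only [h, RΛ, hC]
      rw [← integral_const_mul]
      congr 1 with x
      simp [tanhSech]
      ring
    · simp only [h, RΛ, hA, hB]
      rw [← integral_const_mul, ← integral_sub
        (integrable_tanhSech_sub_mul _ _ integrable_inv_cosh_sq _)
        ((integrable_tanhSech_sub_mul _ _ integrable_tanh_mul_inv_cosh _).const_mul _)]
      congr 1 with x
      simp [tanhSech]
      ring
  have cA : ContDiff ℝ (⊤ : ℕ∞) A := contDiff_integral_tanhSech integrable_inv_cosh_sq _ _
  have cB : ContDiff ℝ (⊤ : ℕ∞) B := contDiff_integral_tanhSech integrable_tanh_mul_inv_cosh _ _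
  have cC : ContDiff ℝ (⊤ : ℕ∞) C := contDiff_integral_tanhSech integrable_inv_cosh _ _
  have hsmooth : ContDiff ℝ (⊤ : ℕ∞) h := by
    rw [hh]
    fun_prop
  have hC0 : C 0 = 2 := by
    rw [← integral_inv_cosh_sq]
    simp only [hC]
    congr 1 with x
    simp [tanhSech]
    ring
  have dA := hasDerivAt_integral_tanhSech Polynomial.X 0 integrable_inv_cosh_sq 0
  have dB := hasDerivAt_integral_tanhSech 0 1 integrable_tanh_mul_inv_cosh 0
  have dC := hasDerivAt_integral_tanhSech 0 1 integrable_inv_cosh 0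
  set A' := -∫ x, tanhSech (Polynomial.derivative Polynomial.X * (1 - Polynomial.X ^ 2))
    (Polynomial.derivative 0 * (1 - Polynomial.X ^ 2) - Polynomial.X * 0) (x - 0)
      * ((cosh x)⁻¹ * (cosh x)⁻¹) with hA'
  set B' := -∫ x, tanhSech (Polynomial.derivative 0 * (1 - Polynomial.X ^ 2))
    (Polynomial.derivative 1 * (1 - Polynomial.X ^ 2) - Polynomial.X * 1) (x - 0)
      * (tanh x * (cosh x)⁻¹) with hB'
  have hAB : A' - B' = -2 := by
    rw [hA', hB', neg_sub_neg, ← integral_sub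
      (integrable_tanhSech_sub_mul _ _ integrable_tanh_mul_inv_cosh _)
      (integrable_tanhSech_sub_mul _ _ integrable_inv_cosh_sq _), ← integral_inv_cosh_sq,
      ← integral_neg]
    congr 1 with x
    simp [tanhSech]
    ring
  have hd : HasFDerivAt h ((-2 : ℝ) • ContinuousLinearMap.id ℝ (ℝ × ℝ)) (0, 0) := by
    have f1 : HasFDerivAt (fun Λ : ℝ × ℝ => Λ.1) (ContinuousLinearMap.fst ℝ ℝ ℝ) (0, 0) :=
      hasFDerivAt_fst
    have f2 : HasFDerivAt (fun Λ : ℝ × ℝ => Λ.2) (ContinuousLinearMap.snd ℝ ℝ ℝ) (0, 0) :=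
      hasFDerivAt_snd
    have eA := dA.comp_hasFDerivAt (0, 0) f2
    have eB := dB.comp_hasFDerivAt (0, 0) f2
    have eC := dC.comp_hasFDerivAt (0, 0) f2
    have es := (hasDerivAt_sin 0).comp_hasFDerivAt (0, 0) f1
    have ec := (hasDerivAt_cos 0).comp_hasFDerivAt (0, 0) f1
    rw [hh]
    refine ((es.neg.mul eC).prodMk (eA.sub (ec.mul eB))).congr_fderiv ?_
    ext <;> simp
    · simpa [hC] using hC0
    · exact hAB
  refine ⟨hsmooth.contDiffAt, hd, ?_⟩
  let e : (ℝ × ℝ) ≃L[ℝ] (ℝ × ℝ) :=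
    ContinuousLinearEquiv.smulLeft (Units.mk0 (-2 : ℝ) (by norm_num))
  have he : (e : (ℝ × ℝ) →L[ℝ] (ℝ × ℝ)) = (-2 : ℝ) • ContinuousLinearMap.id ℝ (ℝ × ℝ) := by
    ext <;> simp [e, Units.smul_def]
  have hs : HasStrictFDerivAt h (e : (ℝ × ℝ) →L[ℝ] (ℝ × ℝ)) (0, 0) :=
    hsmooth.contDiffAt.hasStrictFDerivAt' (he ▸ hd) (by simp)
  exact ⟨hs.localInverse h e (0, 0), hs.localInverse_continuousAt, hs.eventually_left_inverse,
    hs.eventually_right_inverse⟩
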